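/- For every natural number m, Σ_{ℓ=0}^{2m} [2m,ℓ]_q · (−q)^ℓ = Σ_{ℓ=0}^{2m} [2m,ℓ]_q · (−1)^ℓ. -/

import Mathlib

/-- The Gaussian (`q`-binomial) coefficient `[n, k]_q`, defined by the recurrence
`[n, 0]_q = 1`, `[0, k+1]_q = 0`, `[n+1, k+1]_q = [n, k]_q + q^(k+1) * [n, k+1]_q`
(so that `[n+1, k]_q = [n, k-1]_q + q^k * [n, k]_q` and `[n, k]_q = 0` for `k > n`). -/
def qBinom {R : Type*} [CommRing R] (q : R) : ℕ → ℕ → R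
  | _, 0 => 1
  | 0, _ + 1 => 0
  | n + 1, k + 1 => qBinom q n k + q ^ (k + 1) * qBinom q n (k + 1)

/-- The Rogers–Szegő polynomial `∑_{ℓ=0}^{n} [n,ℓ]_q x^ℓ`, evaluated at `x`. -/
def rogersSzego {R : Type*} [CommRing R] (q : R) (n : ℕ) (x : R) : R :=
  ∑ ℓ ∈ Finset.range (n + 1), qBinom q n ℓ * x ^ ℓ

theorem qBinom_zero_right {R : Type*} [CommRing R] (q : R) (n : ℕ) : qBinom q n 0 = 1 := by
  cases n <;> rfl

theorem qBinom_eq_zero_of_lt {R : Type*} [CommRing R] (q : R) {n k : ℕ} (h : n < k) :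
    qBinom q n k = 0 := by
  induction n generalizing k with
  | zero =>
    obtain ⟨k, rfl⟩ := Nat.exists_eq_succ_of_ne_zero h.ne'
    rfl
  | succ n ih =>
    obtain ⟨k, rfl⟩ := Nat.exists_eq_succ_of_ne_zero (Nat.ne_zero_of_lt h)
    change qBinom q n k + q ^ (k + 1) * qBinom q n (k + 1) = 0
    rw [ih (by omega), ih (by omega)]
    simp

theorem rogersSzego_zero {R : Type*} [CommRing R] (q x : R) : rogersSzego q 0 x = 1 := by
  simp [rogersSzego, qBinom_zero_right]

theorem rogersSzego_succ {R : Type*} [CommRing R] (q : R) (n : ℕ) (x : R) :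
    rogersSzego q (n + 1) x = x * rogersSzego q n x + rogersSzego q n (q * x) := by
  have h : rogersSzego q n (q * x) =
      ∑ ℓ ∈ Finset.range (n + 2), qBinom q n ℓ * (q * x) ^ ℓ := by
    rw [Finset.sum_range_succ, qBinom_eq_zero_of_lt q (Nat.lt_succ_self n), zero_mul, add_zero,
      rogersSzego]
  rw [h, rogersSzego, rogersSzego, Finset.sum_range_succ', Finset.sum_range_succ' _ (n + 1),
    Finset.mul_sum, ← add_assoc, ← Finset.sum_add_distrib]
  congr 1
  · refine Finset.sum_congr rfl fun k _ => ?_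
    rw [qBinom]
    ring
  · simp [qBinom_zero_right]

theorem rogersSzego_sub_rogersSzego_mul {R : Type*} [CommRing R] (q : R) (n : ℕ) (x : R) :
    rogersSzego q (n + 1) x - rogersSzego q (n + 1) (q * x) =
      x * (1 - q ^ (n + 1)) * rogersSzego q n x := by
  induction n generalizing x with
  | zero =>
    simp only [rogersSzego_succ, rogersSzego_zero]
    ring
  | succ n ih =>
    rw [rogersSzego_succ q (n + 1) x, rogersSzego_succ q (n + 1) (q * x)]
    linear_combination ih (q * x) + q * x * ih x -
      q * x * (1 - q ^ (n + 1)) * rogersSzego_succ q n x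

theorem rogersSzego_odd_neg_one {R : Type*} [CommRing R] (q : R) (m : ℕ) :
    rogersSzego q (2 * m + 1) (-1) = 0 := by
  induction m with
  | zero => simp [rogersSzego_succ, rogersSzego_zero]
  | succ m ih =>
    have h := rogersSzego_sub_rogersSzego_mul q (2 * m + 1) (-1)
    rw [ih, mul_zero] at h
    rw [show 2 * (m + 1) + 1 = 2 * m + 1 + 1 + 1 by ring, rogersSzego_succ]
    linear_combination -h

/-- `∑_{ℓ=0}^{2m} [2m,ℓ]_q (-q)^ℓ = ∑_{ℓ=0}^{2m} [2m,ℓ]_q (-1)^ℓ`. -/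
theorem gauss_like_sum_even_shift_one {R : Type*} [CommRing R] (q : R) (m : ℕ) :
    ∑ ℓ ∈ Finset.range (2 * m + 1), qBinom q (2 * m) ℓ * (-q) ^ ℓ =
      ∑ ℓ ∈ Finset.range (2 * m + 1), qBinom q (2 * m) ℓ * (-1) ^ ℓ := by
  have h := rogersSzego_succ q (2 * m) (-1)
  rw [rogersSzego_odd_neg_one, mul_neg_one] at h
  change rogersSzego q (2 * m) (-q) = rogersSzego q (2 * m) (-1)
  linear_combination -h
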